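/- Let K be a compact Hausdorff space which is σ-discrete, i.e. K = ⋃_{i∈ℕ} D_i where the D_i are pairwise disjoint and each satisfies D_i ∩ D_i' = ∅. Then for every ε > 0 there exists an equivalent norm N on C(K) which is of class C^∞ on C(K) \ {0} and satisfies ‖f‖∞ ≤ N(f) ≤ (1+ε)‖f‖∞ for all f ∈ C(K). In particular, the supremum norm can be uniformly approximated on bounded subsets of C(K) by infinitely differentiable norms. -/

import Mathlib

open Set Filter Topology
open scoped ContDiff

lemma aux_bump : ∃ p : ℝ → ℝ, ContDiff ℝ ∞ p ∧ ConvexOn ℝ univ p ∧ (∀ x ≤ 0, p x = 0) ∧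
    (∀ x, 0 < x → 0 < p x) ∧ Monotone p := by
  have hcont : Continuous expNegInvGlue :=
    (expNegInvGlue.contDiff (n := 0)).continuous
  set p : ℝ → ℝ := fun x => ∫ t in (0:ℝ)..x, expNegInvGlue t with hp
  have hd : ∀ x, HasDerivAt p (expNegInvGlue x) x := fun x =>
    intervalIntegral.integral_hasDerivAt_right (hcont.intervalIntegrable _ _)
      (hcont.stronglyMeasurableAtFilter _ _) hcont.continuousAt
  have hdiff : Differentiable ℝ p := fun x => (hd x).differentiableAt
  have hderiv : deriv p = expNegInvGlue := funext fun x => (hd x).deriv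
  refine ⟨p, ?_, ?_, ?_, ?_, ?_⟩
  · rw [contDiff_infty_iff_deriv, hderiv]
    exact ⟨hdiff, expNegInvGlue.contDiff⟩
  · apply Monotone.convexOn_univ_of_deriv hdiff
    rw [hderiv]; exact expNegInvGlue.monotone
  · intro x hx
    simp only [hp]
    rw [intervalIntegral.integral_symm, neg_eq_zero]
    rw [intervalIntegral.integral_congr (g := fun _ => (0:ℝ))]
    · simp
    · intro t ht
      rw [uIcc_of_le hx] at ht
      exact expNegInvGlue.zero_of_nonpos ht.2
  · intro x hx
    exact intervalIntegral.intervalIntegral_pos_of_pos_on (hcont.intervalIntegrable _ _)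
      (fun t ht => expNegInvGlue.pos_of_pos ht.1) hx
  · apply monotone_of_deriv_nonneg hdiff
    intro x; rw [hderiv]; exact expNegInvGlue.nonneg x

lemma aux_phi (a b : ℝ) (hab : a < b) : ∃ φ : ℝ → ℝ, ContDiff ℝ ∞ φ ∧
    ConvexOn ℝ univ φ ∧ (∀ x, 0 ≤ φ x) ∧ (∀ x, φ (-x) = φ x) ∧ (∀ x, |x| ≤ a → φ x = 0) ∧
    (∀ x, b ≤ |x| → 1 < φ x) := by
  obtain ⟨p, hs, hc, h0, hpos, hm⟩ := aux_bump
  have hnn : ∀ x, 0 ≤ p x := fun x => by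
    rcases le_or_gt x 0 with h | h
    · exact (h0 x h).ge
    · exact (hpos x h).le
  have hb := hpos (b - a) (by linarith)
  refine ⟨fun x => (2 / p (b - a)) * (p (x - a) + p (-x - a)), ?_, ?_, ?_, ?_, ?_, ?_⟩
  · apply contDiff_const.mul
    exact (hs.comp (by fun_prop)).add (hs.comp (by fun_prop))
  · apply ConvexOn.smul (c := 2 / p (b - a)) (by positivity)
    apply ConvexOn.add
    · refine ⟨convex_univ, fun x _ y _ s t hs ht hst => ?_⟩
      have := hc.2 (mem_univ (x - a)) (mem_univ (y - a)) hs ht hst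
      convert this using 2
      simp only [smul_eq_mul]; linear_combination a * hst
    · refine ⟨convex_univ, fun x _ y _ s t hs ht hst => ?_⟩
      have := hc.2 (mem_univ (-x - a)) (mem_univ (-y - a)) hs ht hst
      convert this using 2
      simp only [smul_eq_mul]; linear_combination a * hst
  · intro x
    have := hnn (x - a); have := hnn (-x - a)
    positivity
  · intro x
    simp only [neg_neg]; ring
  · intro x hx
    have := abs_le.1 hx
    simp only
    rw [h0 (x - a) (by linarith), h0 (-x - a) (by linarith)]; simp
  · intro x hx
    have key : p (b - a) ≤ p (x - a) + p (-x - a) := by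
      rcases le_abs.1 hx with h | h
      · have := hm (show b - a ≤ x - a by linarith)
        linarith [hnn (-x - a)]
      · have := hm (show b - a ≤ -x - a by linarith)
        linarith [hnn (x - a)]
    calc (1:ℝ) < 2 / p (b - a) * p (b - a) := by field_simp; norm_num
      _ ≤ _ := mul_le_mul_of_nonneg_left key (by positivity)

lemma aux_gauge {E : Type*} [NormedAddCommGroup E] [NormedSpace ℝ E] [CompleteSpace E]
    (C : Set E) (hC : Convex ℝ C) (hcl : IsClosed C) (h0 : C ∈ 𝓝 0) (f : E)
    (hf : 0 < gauge C f) (Φ : E → ℝ) (hs : ContDiff ℝ ∞ Φ) (hc : ConvexOn ℝ univ Φ)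
    (hΦ0 : Φ 0 = 0)
    (hloc : ∀ᶠ u in 𝓝 ((gauge C f)⁻¹ • f), (u ∈ C ↔ Φ u ≤ 1)) :
    ContDiffAt ℝ ∞ (gauge C) f := by
  have hgc : Continuous (gauge C) := continuous_gauge hC h0
  -- the boundary condition
  have hbd : ∀ᶠ h in 𝓝 f, Φ ((gauge C h)⁻¹ • h) = 1 := by
    have htend : Tendsto (fun h => (gauge C h)⁻¹ • h) (𝓝 f) (𝓝 ((gauge C f)⁻¹ • f)) :=
      ((hgc.continuousAt.inv₀ hf.ne').smul continuousAt_id)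
    have h1 := htend.eventually (eventually_eventually_nhds.2 hloc)
    have h2 : ∀ᶠ h in 𝓝 f, 0 < gauge C h := hgc.continuousAt.eventually (lt_mem_nhds hf)
    filter_upwards [h1, h2] with h hh1 hh2
    set u := (gauge C h)⁻¹ • h with hu
    have hgu : gauge C u = 1 := by
      rw [hu, gauge_smul_of_nonneg (by positivity), smul_eq_mul, inv_mul_cancel₀ hh2.ne']
    have huC : u ∈ C := by
      rw [← hcl.closure_eq]
      exact (gauge_le_one_iff_mem_closure hC h0).1 hgu.le
    refine le_antisymm (hh1.self_of_nhds.1 huC) ?_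
    by_contra hlt
    push Not at hlt
    have hl : Tendsto (fun l : ℝ => l • u) (𝓝 1) (𝓝 u) := by
      have : Continuous (fun l : ℝ => l • u) := by fun_prop
      simpa using this.tendsto 1
    have h3 : ∀ᶠ v in 𝓝 u, Φ v < 1 := hs.continuous.continuousAt.eventually (gt_mem_nhds hlt)
    have h4 := hl.eventually (hh1.and h3)
    have h5 : ∀ᶠ l : ℝ in 𝓝[>] 1, 1 < l := self_mem_nhdsWithin
    obtain ⟨l, ⟨hl1, hl2⟩, hl3⟩ := ((h4.filter_mono nhdsWithin_le_nhds).and h5).exists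
    have := gauge_le_one_of_mem (hl1.2 hl2.le)
    rw [gauge_smul_of_nonneg (by linarith), smul_eq_mul, hgu] at this
    linarith
  set G : E × ℝ → ℝ := fun x => Φ (x.2 • x.1) with hG
  set s0 := (gauge C f)⁻¹ with hs0
  have hs0pos : 0 < s0 := inv_pos.2 hf
  have hGs : ContDiff ℝ ∞ G := hs.comp (contDiff_snd.smul contDiff_fst)
  have cdf : ContDiffAt ℝ ∞ G (f, s0) := hGs.contDiffAt
  have hn : (∞ : WithTop ℕ∞) ≠ 0 := by simp
  have hG1 : G (f, s0) = 1 := hbd.self_of_nhds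
  have hder : HasDerivAt (fun s : ℝ => Φ (s • f)) ((fderiv ℝ G (f, s0)) (0, 1)) s0 := by
    have h1 : HasFDerivAt G (fderiv ℝ G (f, s0)) (f, s0) :=
      (cdf.differentiableAt hn).hasFDerivAt
    have h2 : HasDerivAt (fun s : ℝ => (f, s)) ((0 : E), (1:ℝ)) s0 :=
      (hasDerivAt_const s0 f).prodMk (hasDerivAt_id s0)
    exact h1.comp_hasDerivAt s0 h2
  have hne : (fderiv ℝ G (f, s0)) (0, 1) ≠ 0 := by
    have hconv : ConvexOn ℝ univ (fun s : ℝ => Φ (s • f)) :=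
      hc.comp_linearMap (LinearMap.toSpanSingleton ℝ E f)
    have := hconv.slope_le_of_hasDerivAt (mem_univ 0) (mem_univ s0) hs0pos hder
    have h2 : 0 < slope (fun s : ℝ => Φ (s • f)) 0 s0 := by
      rw [slope_def_field]
      have : Φ (s0 • f) = 1 := hG1
      simp only [this, zero_smul, hΦ0]
      simp [hs0pos]
    linarith
  have hinv : (fderiv ℝ G (f, s0) ∘L .inr ℝ E ℝ).IsInvertible := by
    refine ⟨ContinuousLinearEquiv.unitsEquivAut ℝ (Units.mk0 _ hne), ?_⟩
    ext
    simp
  have hIC := cdf.contDiffAt_implicitFunction hn hinv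
  have hIE := cdf.eventually_apply_eq_iff_implicitFunction hn hinv
  have htend : Tendsto (fun h => (h, (gauge C h)⁻¹)) (𝓝 f) (𝓝 (f, s0)) :=
    continuousAt_id.prodMk (hgc.continuousAt.inv₀ hf.ne')
  have heq : (gauge C) =ᶠ[𝓝 f] fun h => (cdf.implicitFunction hn hinv h)⁻¹ := by
    filter_upwards [htend.eventually hIE, hbd] with h h1 h2
    rw [h1.1 (by rw [hG1]; exact h2)]
    simp
  refine ContDiffAt.congr_of_eventuallyEq ?_ heq
  apply hIC.inv
  have := cdf.implicitFunction_apply_self hn hinv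
  simp only at this
  rw [this]; exact hs0pos.ne'

lemma aux_weights (K : Type*) [TopologicalSpace K] [T1Space K] (D : ℕ → Set K)
    (hcover : ⋃ i, D i = Set.univ) (hdiscr : ∀ i, D i ∩ derivedSet (D i) = ∅)
    (ε : ℝ) (hε : 0 < ε) :
    ∃ B S : K → ℝ, (∀ t, 1 ≤ S t) ∧ (∀ t, S t < B t) ∧ (∀ t, B t ≤ 1 + ε) ∧
      ∀ t, ∃ c, 0 < c ∧ c < S t ∧ ∀ᶠ s in 𝓝 t, s ≠ t → B s ≤ c := by
  classical
  have hex : ∀ t, ∃ n, t ∈ D n := fun t => by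
    have : t ∈ ⋃ i, D i := hcover ▸ mem_univ t
    simpa using this
  choose n hn using hex
  set c : ℕ → ℝ := fun i => ε / 2 * (1 / 2) ^ i with hcdef
  have hcpos : ∀ i, 0 < c i := fun i => by positivity
  have hsum : ∀ J, HasSum (fun i => c (i + J)) (ε * (1 / 2) ^ J) := by
    intro J
    have := (hasSum_geometric_two).mul_left (ε / 2 * (1 / 2) ^ J)
    have e1 : (fun i => c (i + J)) = fun i => ε / 2 * (1 / 2) ^ J * (1 / 2) ^ i := by
      funext i; simp only [hcdef, pow_add]; ring
    have e2 : ε * (1 / 2) ^ J = ε / 2 * (1 / 2) ^ J * 2 := by ring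
    rw [e1, e2]; exact this
  set T : K → ℕ → ℝ := fun t i => (closure (D i)).indicator (fun _ => c i) t with hT
  have hT0 : ∀ t i, 0 ≤ T t i := fun t i => indicator_nonneg (fun _ _ => (hcpos i).le) _
  have hTc : ∀ t i, T t i ≤ c i := fun t i => indicator_le_self' (fun _ _ => (hcpos i).le) _
  have hcs : Summable c := (hsum 0).summable
  have hTs : ∀ t, Summable (T t) := fun t => Summable.of_nonneg_of_le (hT0 t) (hTc t) hcs
  have hTn : ∀ t, T t (n t) = c (n t) := fun t =>
    indicator_of_mem (subset_closure (hn t)) _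
  have hge : ∀ t, c (n t) ≤ ∑' i, T t i := fun t => by
    rw [← hTn t]; exact (hTs t).le_tsum _ (fun j _ => hT0 t j)
  refine ⟨fun t => 1 + ∑' i, T t i, fun t => 1 + ∑' i, T t i - c (n t) / 2, ?_, ?_, ?_, ?_⟩
  · intro t; simp only; linarith [hge t, hcpos (n t)]
  · intro t; simp only; linarith [hcpos (n t)]
  · intro t
    have h1 : ∑' i, T t i ≤ ∑' i, c i := (hTs t).tsum_le_tsum (hTc t) hcs
    have h2 : ∑' i, c i = ε := by simpa using (hsum 0).tsum_eq
    simp only; linarith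
  · intro t
    refine ⟨1 + ∑' i, T t i - 3 / 4 * c (n t), by linarith [hge t, hcpos (n t)],
      by linarith [hcpos (n t)], ?_⟩
    set J := n t + 3 with hJ
    have hA : ∀ᶠ s in 𝓝 t, ∀ i ∈ Finset.range J, T s i ≤ T t i := by
      rw [Filter.eventually_all_finset]
      intro i _
      by_cases h : t ∈ closure (D i)
      · have : T t i = c i := indicator_of_mem h _
        rw [this]; exact Eventually.of_forall fun s => hTc s i
      · filter_upwards [isClosed_closure.isOpen_compl.mem_nhds h] with s hs
        have : T s i = 0 := indicator_of_notMem hs _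
        rw [this]; exact hT0 t i
    have hB : ∀ᶠ s in 𝓝 t, s ≠ t → T s (n t) = 0 := by
      have hna : ¬ AccPt t (𝓟 (D (n t))) := fun h => by
        have : t ∈ D (n t) ∩ derivedSet (D (n t)) := ⟨hn t, h⟩
        rw [hdiscr] at this; exact this
      rw [accPt_iff_nhds] at hna
      push Not at hna
      obtain ⟨U, hU, hUD⟩ := hna
      obtain ⟨V, hVU, hV, htV⟩ := mem_nhds_iff.1 hU
      filter_upwards [hV.mem_nhds htV] with s hs hst
      apply indicator_of_notMem
      intro hcl
      obtain ⟨y, hy, hyD⟩ := mem_closure_iff.1 hcl (V ∩ {t}ᶜ) (hV.inter isOpen_compl_singleton)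
        ⟨hs, hst⟩
      exact hy.2 (hUD y ⟨hVU hy.1, hyD⟩)
    filter_upwards [hA, hB] with s h1 h2 hst
    have e1 := (hTs s).sum_add_tsum_nat_add J
    have e2 := (hTs t).sum_add_tsum_nat_add J
    have t1 : ∑' i, T s (i + J) ≤ ε * (1 / 2) ^ J := by
      rw [← (hsum J).tsum_eq]
      exact ((summable_nat_add_iff J).2 (hTs s)).tsum_le_tsum (fun i => hTc s _) (hsum J).summable
    have t2 : 0 ≤ ∑' i, T t (i + J) := tsum_nonneg fun i => hT0 t _
    have hmem : n t ∈ Finset.range J := by simp [hJ]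
    have s1 := Finset.add_sum_erase _ (T s) hmem
    have s2 := Finset.add_sum_erase _ (T t) hmem
    have s3 : ∑ i ∈ (Finset.range J).erase (n t), T s i ≤
        ∑ i ∈ (Finset.range J).erase (n t), T t i :=
      Finset.sum_le_sum fun i hi => h1 i (Finset.mem_of_mem_erase hi)
    have hc4 : ε * (1 / 2) ^ J = c (n t) / 4 := by
      simp only [hcdef, hJ, pow_add]; ring
    rw [h2 hst] at s1
    rw [hTn t] at s2
    linarith

lemma aux_finite (K : Type*) [TopologicalSpace K] [CompactSpace K]
    (B S : K → ℝ) (hS : ∀ t, 1 ≤ S t) (hSB : ∀ t, S t < B t)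
    (hW : ∀ t, ∃ c, 0 < c ∧ c < S t ∧ ∀ᶠ s in 𝓝 t, s ≠ t → B s ≤ c)
    (g : C(K, ℝ)) (hg : ∀ t, |g t| ≤ (S t)⁻¹) :
    ∃ F : Finset K, ∀ᶠ u : C(K, ℝ) in 𝓝 g, ∀ t ∉ F, |u t| ≤ (B t)⁻¹ := by
  classical
  have key : ∀ t, ∃ δ : ℝ, 0 < δ ∧ ∀ᶠ s in 𝓝 t, s ≠ t → |g s| + δ ≤ (B s)⁻¹ := by
    intro t
    obtain ⟨c, hc0, hcS, hc⟩ := hW t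
    have h1 : (S t)⁻¹ < c⁻¹ := inv_strictAnti₀ hc0 hcS
    refine ⟨(c⁻¹ - (S t)⁻¹) / 2, by linarith, ?_⟩
    have hcont : ContinuousAt (fun s => |g s|) t := by fun_prop
    have h2 : ∀ᶠ s in 𝓝 t, |g s| < (c⁻¹ + (S t)⁻¹) / 2 :=
      hcont.eventually (gt_mem_nhds (by linarith [hg t]))
    filter_upwards [hc, h2] with s hs1 hs2 hst
    have : c⁻¹ ≤ (B s)⁻¹ := inv_anti₀ (by linarith [hS s, hSB s]) (hs1 hst)
    linarith
  choose δ hδ hev using key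
  obtain ⟨F, hF⟩ := (isCompact_univ (X := K)).elim_nhds_subcover
    (fun t => {s | s ≠ t → |g s| + δ t ≤ (B s)⁻¹}) (fun t _ => hev t)
  refine ⟨F, ?_⟩
  have h1 : ∀ᶠ u : C(K, ℝ) in 𝓝 g, ∀ x ∈ F, ‖u - g‖ < δ x := by
    rw [Filter.eventually_all_finset]
    intro x _
    filter_upwards [Metric.ball_mem_nhds g (hδ x)] with u hu
    rwa [Metric.mem_ball, dist_eq_norm] at hu
  filter_upwards [h1] with u hu t ht
  have := hF.2 (mem_univ t)
  simp only [mem_iUnion, mem_ofPred_eq] at this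
  obtain ⟨x, hxF, hx⟩ := this
  have h2 := hx (fun h => ht (h ▸ hxF))
  have h3 := (u - g).norm_coe_le_norm t
  rw [ContinuousMap.sub_apply, Real.norm_eq_abs] at h3
  have h4 := hu x hxF
  have h5 : |u t| ≤ |g t| + |u t - g t| := by
    have := abs_add_le (g t) (u t - g t)
    simpa using this
  linarith

lemma aux_gauge_smul {E : Type*} [NormedAddCommGroup E] [NormedSpace ℝ E] (C : Set E)
    (hsymm : ∀ f ∈ C, -f ∈ C) (a : ℝ) (f : E) : gauge C (a • f) = |a| * gauge C f := by
  rcases le_total 0 a with h | h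
  · rw [gauge_smul_of_nonneg h, abs_of_nonneg h, smul_eq_mul]
  · have h1 : a • f = -((-a) • f) := by simp
    rw [h1, gauge_neg hsymm, gauge_smul_of_nonneg (by linarith), abs_of_nonpos h, smul_eq_mul]

lemma aux_gauge_low {E : Type*} [NormedAddCommGroup E] [NormedSpace ℝ E] (C : Set E)
    (h0 : C ∈ 𝓝 0) (hsub : C ⊆ Metric.closedBall 0 1) (f : E) : ‖f‖ ≤ gauge C f := by
  have := le_gauge_of_subset_closedBall (absorbent_nhds_zero h0) zero_le_one hsub (x := f)
  simpa using this

lemma aux_gauge_add {E : Type*} [NormedAddCommGroup E] [NormedSpace ℝ E] (C : Set E)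
    (hC : Convex ℝ C) (h0 : C ∈ 𝓝 0) (f g : E) : gauge C (f + g) ≤ gauge C f + gauge C g :=
  gauge_add_le hC (absorbent_nhds_zero h0) f g

lemma aux_gauge_up {E : Type*} [NormedAddCommGroup E] [NormedSpace ℝ E] (C : Set E)
    (r : ℝ) (hr : 0 < r) (hball : Metric.ball 0 r⁻¹ ⊆ C) (f : E) : gauge C f ≤ r * ‖f‖ := by
  have h := mul_gauge_le_norm hball (x := f)
  rwa [inv_mul_le_iff₀ hr] at h

set_option maxHeartbeats 1000000 in
theorem stmt_16 (K : Type*) [TopologicalSpace K] [CompactSpace K] [T2Space K]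
    (D : ℕ → Set K)
    (hdisj : Pairwise (Function.onFun Disjoint D))
    (hcover : ⋃ i, D i = Set.univ)
    (hdiscr : ∀ i, D i ∩ derivedSet (D i) = ∅)
    (ε : ℝ) (hε : 0 < ε) :
    ∃ N : C(K, ℝ) → ℝ,
      (∀ f g : C(K, ℝ), N (f + g) ≤ N f + N g) ∧
      (∀ (a : ℝ) (f : C(K, ℝ)), N (a • f) = |a| * N f) ∧
      (∀ f : C(K, ℝ), N f = 0 ↔ f = 0) ∧
      ContDiffOn ℝ ((⊤ : ℕ∞) : WithTop ℕ∞) N {f : C(K, ℝ) | f ≠ 0} ∧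
      (∀ f : C(K, ℝ), ‖f‖ ≤ N f ∧ N f ≤ (1 + ε) * ‖f‖) := by
  classical
  obtain ⟨B, S, hS, hSB, hB, hW⟩ := aux_weights K D hcover hdiscr ε hε
  have hSpos : ∀ t, 0 < S t := fun t => by linarith [hS t]
  have hBpos : ∀ t, 0 < B t := fun t => (hSpos t).trans (hSB t)
  choose φ hφs hφc hφ0 hφe hφz hφ1 using fun t =>
    aux_phi (B t)⁻¹ (S t)⁻¹ (inv_strictAnti₀ (hSpos t) (hSB t))
  set Φ : Finset K → C(K, ℝ) → ℝ := fun F f => ∑ t ∈ F, φ t (f t) with hΦ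
  have hΦs : ∀ F, ContDiff ℝ ∞ (Φ F) := fun F =>
    ContDiff.sum fun t _ => (hφs t).comp
      (ContinuousMap.evalCLM ℝ t : C(K, ℝ) →L[ℝ] ℝ).contDiff
  have hΦc : ∀ F, ConvexOn ℝ univ (Φ F) := by
    intro F
    refine ⟨convex_univ, fun x _ y _ a b ha hb hab => ?_⟩
    simp only [hΦ, Finset.smul_sum, ← Finset.sum_add_distrib]
    exact Finset.sum_le_sum fun t _ => (hφc t).2 (mem_univ (x t)) (mem_univ (y t)) ha hb hab
  have hΦ0 : ∀ F, Φ F 0 = 0 := fun F => Finset.sum_eq_zero fun t _ =>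
    hφz t _ (by simpa using (hBpos t).le)
  set C : Set C(K, ℝ) := ⋂ F, {f | Φ F f ≤ 1} with hCdef
  have hCmem : ∀ f, f ∈ C ↔ ∀ F, Φ F f ≤ 1 := fun f => by simp [hCdef]
  have hC : Convex ℝ C := convex_iInter fun F => by
    simpa using (hΦc F).convex_le 1
  have hCcl : IsClosed C := isClosed_iInter fun F =>
    isClosed_le (hΦs F).continuous continuous_const
  have hCb : ∀ f ∈ C, ∀ t, |f t| ≤ (S t)⁻¹ := by
    intro f hf t
    by_contra h
    push Not at h
    have h1 := (hCmem f).1 hf {t}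
    simp only [hΦ, Finset.sum_singleton] at h1
    linarith [hφ1 t _ h.le]
  have hCsub : C ⊆ Metric.closedBall 0 1 := by
    intro f hf
    rw [mem_closedBall_zero_iff, ContinuousMap.norm_le _ zero_le_one]
    intro t
    exact (hCb f hf t).trans (inv_le_one_of_one_le₀ (hS t))
  have hball : Metric.ball 0 (1 + ε)⁻¹ ⊆ C := by
    intro f hf
    rw [mem_ball_zero_iff] at hf
    rw [hCmem]
    intro F
    have : Φ F f = 0 := Finset.sum_eq_zero fun t _ => hφz t _ (by
      have h1 := f.norm_coe_le_norm t
      rw [Real.norm_eq_abs] at h1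
      have h2 : (1 + ε)⁻¹ ≤ (B t)⁻¹ := inv_anti₀ (hBpos t) (hB t)
      linarith)
    rw [this]; exact zero_le_one
  have hC0 : C ∈ 𝓝 0 := mem_of_superset (Metric.ball_mem_nhds _ (by positivity)) hball
  have hsymm : ∀ f ∈ C, -f ∈ C := by
    intro f hf
    rw [hCmem] at hf ⊢
    intro F
    have : Φ F (-f) = Φ F f := Finset.sum_congr rfl fun t _ => hφe t (f t)
    rw [this]; exact hf F
  have hlow : ∀ f, ‖f‖ ≤ gauge C f := aux_gauge_low C hC0 hCsub
  have hup : ∀ f, gauge C f ≤ (1 + ε) * ‖f‖ := aux_gauge_up C (1 + ε) (by positivity) hball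
  refine ⟨gauge C, aux_gauge_add C hC hC0, ?_, ?_, ?_, fun f => ⟨hlow f, hup f⟩⟩
  · exact fun a f => aux_gauge_smul C hsymm a f
  · intro f
    constructor
    · intro h
      have := hlow f
      rw [h] at this
      exact norm_le_zero_iff.1 this
    · rintro rfl; exact gauge_zero
  · intro f hf
    have hfpos : 0 < gauge C f := (norm_pos_iff.2 hf).trans_le (hlow f)
    apply ContDiffAt.contDiffWithinAt
    have hgC : (gauge C f)⁻¹ • f ∈ C := by
      apply hCcl.closure_subset
      apply (gauge_le_one_iff_mem_closure hC hC0).1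
      rw [aux_gauge_smul C hsymm, abs_of_pos (inv_pos.2 hfpos), inv_mul_cancel₀ hfpos.ne']
    obtain ⟨F, hF⟩ := aux_finite K B S hS hSB hW _ (hCb _ hgC)
    refine aux_gauge C hC hCcl hC0 f hfpos (Φ F) (hΦs F) (hΦc F) (hΦ0 F) ?_
    filter_upwards [hF] with u hu
    rw [hCmem]
    refine ⟨fun h => h F, fun h F' => ?_⟩
    have h1 : Φ F' u ≤ Φ (F' ∪ F) u :=
      Finset.sum_le_sum_of_subset_of_nonneg Finset.subset_union_left fun t _ _ => hφ0 t _
    have h2 : Φ F u = Φ (F' ∪ F) u :=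
      Finset.sum_subset Finset.subset_union_right fun t _ ht => hφz t _ (hu t ht)
    linarith
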